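/- Let (Ω, 𝓕, P) be a probability space, let c ≥ 0 be a constant, let N : Ω → ℝ be measurable, and let A : Ω → ℝ be measurable with 0 ≤ A ≤ c almost surely. Suppose that E[ exp( εN − ε²A/2 ) ] = 1 and E[ exp( −εN − ε²A/2 ) ] = 1 for every ε > 0. Then N is integrable, and for every bounded measurable G : Ω → ℝ, lim_{ε → 0⁺} ε⁻¹ ( E[ G · exp( εN − ε²A/2 ) ] − E[G] ) = E[ G · N ]. (This is the analytic core of Proposition 3.1 of the paper: with N = ∫_0^T ⟨h'(t), dB_t⟩ and A = ∫_0^T |h'(t)|² dt ≤ c for h in the bounded adapted Cameron–Martin class, differentiating the Girsanov density R^{ε,h} = exp( ε∫_0^T ⟨h'(t), dB_t⟩ − (ε²/2)∫_0^T |h'(t)|² dt ) at ε = 0 gives lim_{ε↓0} ε⁻¹ E[F(X^{ε,h}) − F(X)] = E[ F(X) ∫_0^T ⟨h'(t), dB_t⟩ ].) -/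

import Mathlib

open MeasureTheory Set Filter

theorem Real.abs_exp_sub_one_le_abs_mul_exp_abs (y : ℝ) :
    |Real.exp y - 1| ≤ |y| * Real.exp |y| := by
  have hy : y ≤ |y| := le_abs_self y
  have h1 := Real.add_one_le_exp y
  have h2 := Real.add_one_le_exp (-y)
  have h3 : Real.exp y * Real.exp (-y) = 1 := by rw [← Real.exp_add]; simp
  have h4 : Real.exp y ≤ Real.exp |y| := Real.exp_le_exp.2 hy
  have h5 : 1 ≤ Real.exp |y| := Real.one_le_exp (abs_nonneg y)
  rw [abs_le]
  constructor
  · nlinarith [neg_abs_le y, abs_nonneg y]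
  · have h6 : Real.exp y - 1 ≤ y * Real.exp y := by nlinarith [Real.exp_pos y]
    have h7 : y * Real.exp y ≤ |y| * Real.exp |y| :=
      mul_le_mul hy h4 (Real.exp_pos y).le (abs_nonneg y)
    exact h6.trans h7

/-- The difference quotient of the density at `0` is bounded uniformly in `ε ∈ (0, 1]`. -/
theorem abs_inv_mul_exp_sub_one_le {ε n a c : ℝ} (hε : 0 < ε) (hε1 : ε ≤ 1)
    (ha : a ∈ Icc 0 c) :
    |ε⁻¹ * (Real.exp (ε * n - ε ^ 2 * a / 2) - 1)| ≤
      Real.exp c * (Real.exp (2 * n) + Real.exp (-(2 * n))) := by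
  have hy : |ε * n - ε ^ 2 * a / 2| ≤ ε * (|n| + c / 2) := by
    have h1 : ε * n - ε ^ 2 * a / 2 = ε * (n - ε * a / 2) := by ring
    rw [h1, abs_mul, abs_of_pos hε]
    refine mul_le_mul_of_nonneg_left ?_ hε.le
    refine (abs_sub _ _).trans ?_
    have h2 : 0 ≤ ε * a / 2 := by have := mul_nonneg hε.le ha.1; linarith
    rw [abs_of_nonneg h2]
    nlinarith [ha.1, ha.2]
  have hm : 0 ≤ |n| + c / 2 := by linarith [abs_nonneg n, ha.1, ha.2]
  calc |ε⁻¹ * (Real.exp (ε * n - ε ^ 2 * a / 2) - 1)|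
      = ε⁻¹ * |Real.exp (ε * n - ε ^ 2 * a / 2) - 1| := by
        rw [abs_mul, abs_of_pos (inv_pos.2 hε)]
    _ ≤ ε⁻¹ * (ε * (|n| + c / 2) * Real.exp (|n| + c / 2)) := by
        refine mul_le_mul_of_nonneg_left ?_ (inv_pos.2 hε).le
        refine (Real.abs_exp_sub_one_le_abs_mul_exp_abs _).trans ?_
        refine mul_le_mul hy (Real.exp_le_exp.2 (hy.trans ?_)) (Real.exp_pos _).le
          (mul_nonneg hε.le hm)
        exact mul_le_of_le_one_left hm hε1
    _ = (|n| + c / 2) * Real.exp (|n| + c / 2) := by field_simp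
    _ ≤ Real.exp (|n| + c / 2) * Real.exp (|n| + c / 2) := by
        refine mul_le_mul_of_nonneg_right ?_ (Real.exp_pos _).le
        linarith [Real.add_one_le_exp (|n| + c / 2)]
    _ = Real.exp c * Real.exp |2 * n| := by
        rw [← Real.exp_add, ← Real.exp_add, abs_mul, abs_two]; ring_nf
    _ ≤ Real.exp c * (Real.exp (2 * n) + Real.exp (-(2 * n))) :=
        mul_le_mul_of_nonneg_left (Real.exp_abs_le _) (Real.exp_pos c).le

theorem MeasureTheory.Integrable.exp_of_exp_sub {Ω : Type*} [MeasurableSpace Ω] {P : Measure Ω}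
    {M B : Ω → ℝ} {b : ℝ} (hM : Measurable M) (hB : ∀ᵐ ω ∂P, B ω ≤ b)
    (h : Integrable (fun ω => Real.exp (M ω - B ω)) P) :
    Integrable (fun ω => Real.exp (M ω)) P := by
  refine (h.const_mul (Real.exp b)).mono' hM.exp.aestronglyMeasurable ?_
  filter_upwards [hB] with ω hω
  rw [Real.norm_eq_abs, Real.abs_exp, ← Real.exp_add]
  exact Real.exp_le_exp.2 (by linarith)

theorem hasDerivAt_exp_mul_sub_sq_mul (n a : ℝ) :
    HasDerivAt (fun ε : ℝ => Real.exp (ε * n - ε ^ 2 * a / 2)) n 0 := by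
  have h := (((hasDerivAt_id (0 : ℝ)).mul_const n).sub
    ((((hasDerivAt_id (0 : ℝ)).pow 2).mul_const a).div_const 2)).exp
  simpa using h

/-- Analytic core of Proposition 3.1 of the paper: with
`N = ∫_0^T ⟨h'(t), dB_t⟩` and `A = ∫_0^T |h'(t)|² dt ≤ c`, the exponential-martingale
normalization identities `E[exp(±εN − ε²A/2)] = 1` imply that `N` is integrable and
that differentiating the Girsanov density at `ε = 0` gives
`lim_{ε→0⁺} ε⁻¹ (E[G e^{εN − ε²A/2}] − E[G]) = E[G N]` for every bounded measurable `G`. -/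
theorem stmt_8
    {Ω : Type*} [MeasurableSpace Ω] (P : Measure Ω) [IsProbabilityMeasure P]
    (c : ℝ) (hc : 0 ≤ c)
    (N A : Ω → ℝ) (hN : Measurable N) (hA : Measurable A)
    (hA_bdd : ∀ᵐ ω ∂P, A ω ∈ Icc 0 c)
    (hpos : ∀ ε : ℝ, 0 < ε → ∫ ω, Real.exp (ε * N ω - ε ^ 2 * A ω / 2) ∂P = 1)
    (hneg : ∀ ε : ℝ, 0 < ε → ∫ ω, Real.exp (-(ε * N ω) - ε ^ 2 * A ω / 2) ∂P = 1) :
    Integrable N P ∧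
    ∀ G : Ω → ℝ, Measurable G → (∃ cG, ∀ ω, |G ω| ≤ cG) →
      Tendsto
        (fun ε : ℝ =>
          ε⁻¹ * ((∫ ω, G ω * Real.exp (ε * N ω - ε ^ 2 * A ω / 2) ∂P) - ∫ ω, G ω ∂P))
        (nhdsWithin 0 (Ioi 0))
        (nhds (∫ ω, G ω * N ω ∂P)) := by
  have integrable_exp_pos : Integrable (fun ω => Real.exp (2 * N ω)) P := by
    refine Integrable.exp_of_exp_sub (B := fun ω => 2 ^ 2 * A ω / 2) (b := 2 * c)
      (hN.const_mul 2) ?_ (Integrable.of_integral_ne_zero ?_)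
    · filter_upwards [hA_bdd] with ω hω
      linarith [hω.2]
    · rw [hpos 2 two_pos]; exact one_ne_zero
  have integrable_exp_neg : Integrable (fun ω => Real.exp (-(2 * N ω))) P := by
    refine Integrable.exp_of_exp_sub (B := fun ω => 2 ^ 2 * A ω / 2) (b := 2 * c)
      (hN.const_mul 2).neg ?_ (Integrable.of_integral_ne_zero ?_)
    · filter_upwards [hA_bdd] with ω hω
      linarith [hω.2]
    · rw [hneg 2 two_pos]; exact one_ne_zero
  have integrable_sum := integrable_exp_pos.add integrable_exp_neg
  refine ⟨integrable_sum.mono' hN.aestronglyMeasurable (ae_of_all _ fun ω => ?_), ?_⟩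
  · have h1 := Real.add_one_le_exp |2 * N ω|
    have h2 := Real.exp_abs_le (2 * N ω)
    rw [abs_mul, abs_two] at h1 h2
    simp only [Pi.add_apply, Real.norm_eq_abs]
    linarith [abs_nonneg (N ω)]
  rintro G hG ⟨cG, hcG⟩
  have density_meas (ε : ℝ) : Measurable fun ω => Real.exp (ε * N ω - ε ^ 2 * A ω / 2) := by
    fun_prop
  have integrable_G : Integrable G P :=
    (integrable_const cG).mono' hG.aestronglyMeasurable (ae_of_all _ hcG)
  have integrable_G_density (ε : ℝ) (hε : 0 < ε) :
      Integrable (fun ω => G ω * Real.exp (ε * N ω - ε ^ 2 * A ω / 2)) P := by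
    refine Integrable.bdd_mul (c := cG) (Integrable.of_integral_ne_zero ?_)
      hG.aestronglyMeasurable (ae_of_all _ hcG)
    rw [hpos ε hε]; exact one_ne_zero
  have quotient_limit : Tendsto
      (fun ε : ℝ => ∫ ω, G ω * (ε⁻¹ * (Real.exp (ε * N ω - ε ^ 2 * A ω / 2) - 1)) ∂P)
      (nhdsWithin 0 (Ioi 0)) (nhds (∫ ω, G ω * N ω ∂P)) := by
    refine tendsto_integral_filter_of_dominated_convergence
      (fun ω => cG * (Real.exp c * (Real.exp (2 * N ω) + Real.exp (-(2 * N ω))))) ?_ ?_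
      ((integrable_sum.const_mul (Real.exp c)).const_mul cG) ?_
    · exact Eventually.of_forall fun ε =>
        (hG.mul (((density_meas ε).sub_const 1).const_mul ε⁻¹)).aestronglyMeasurable
    · filter_upwards [Ioc_mem_nhdsGT (zero_lt_one' ℝ)] with ε hε
      filter_upwards [hA_bdd] with ω hω
      rw [norm_mul]
      exact mul_le_mul (hcG ω) (abs_inv_mul_exp_sub_one_le hε.1 hε.2 hω) (norm_nonneg _)
        ((abs_nonneg _).trans (hcG ω))
    · refine ae_of_all _ fun ω => Tendsto.const_mul (G ω) ?_
      simpa using (hasDerivAt_exp_mul_sub_sq_mul (N ω) (A ω)).tendsto_slope_zero_right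
  refine quotient_limit.congr' ?_
  filter_upwards [self_mem_nhdsWithin] with ε hε
  rw [← integral_sub (integrable_G_density ε hε) integrable_G, ← integral_const_mul]
  congr 1 with ω
  ring
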